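/- arXiv:1707.08099 — 3 statements merged into one kernel-verified Lean document; each statement's English description precedes it below -/
import Mathlib

section
/- Let P be a poset, let C : x_0, x_1, …, x_t be a forcing cycle in P with val(C) = 0, and let (c,τ) be any {A,B,C,D}-representation of P. Then c(x_i) = c(x_0) + val_C(x_i) for all i with 0 ≤ i ≤ t. -/
/-- The four interval types. -/
inductive IType : Type
  | A
  | B
  | C
  | D
  deriving DecidableEq

/-- `typeComp s t` holds iff `s = B`, or `t = B`, or `s = t = C`, or `s = t = D`. -/
def typeComp : IType → IType → Prop := fun s t =>
  s = IType.B ∨ t = IType.B ∨ (s = IType.C ∧ t = IType.C) ∨ (s = IType.D ∧ t = IType.D)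

/-- An `S`-representation of the poset `(X, prec)`: centers `c` and types `τ` with
`τ x ∈ S` for all `x`, such that `prec x y ↔ c x + 1 < c y ∨ (c x + 1 = c y ∧ comp (τ x) (τ y))`. -/
def SRep {X : Type*} (prec : X → X → Prop) (S : Set IType) (c : X → ℝ) (τ : X → IType) : Prop :=
  (∀ x, τ x ∈ S) ∧
    ∀ x y, prec x y ↔ (c x + 1 < c y ∨ (c x + 1 = c y ∧ typeComp (τ x) (τ y)))

/-- A poset is an `S`-order if it admits an `S`-representation. -/
def SOrder {X : Type*} (prec : X → X → Prop) (S : Set IType) : Prop :=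
  ∃ c τ, SRep prec S c τ

/-- Incomparability `x ∥ y`. -/
def Incomp {X : Type*} (prec : X → X → Prop) (x y : X) : Prop :=
  ¬ prec x y ∧ ¬ prec y x

/-- `x 0, x 1, …, x t` is a forcing trail: each step is an up-step or a side-step. -/
def ForcingTrail {X : Type*} (prec : X → X → Prop) (t : ℕ) (x : ℕ → X) : Prop :=
  ∀ i < t, prec (x i) (x (i + 1)) ∨ Incomp prec (x i) (x (i + 1))

open scoped Classical in
/-- `trailVal prec x i` = number of up-steps minus number of side-steps among the
first `i` steps of the trail `x`. -/
noncomputable def trailVal {X : Type*} (prec : X → X → Prop) (x : ℕ → X) (i : ℕ) : ℤ :=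
  ∑ j ∈ Finset.range i, if prec (x j) (x (j + 1)) then 1 else -1

/-- A unit interval order. -/
def UnitIntervalOrder {X : Type*} (prec : X → X → Prop) : Prop :=
  ∃ f : X → ℝ, ∀ x y, prec x y ↔ f x + 1 < f y

/-- Exchange the types `C` and `D`, fixing `A` and `B`. -/
def swapCD : IType → IType
  | IType.C => IType.D
  | IType.D => IType.C
  | t => t

/-- Two distinct elements are twins if they are incomparable and have the same
comparabilities with every other element. -/
def Twins {X : Type*} (prec : X → X → Prop) (x y : X) : Prop :=
  x ≠ y ∧ Incomp prec x y ∧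
    ∀ z, z ≠ x → z ≠ y → ((prec z x ↔ prec z y) ∧ (prec x z ↔ prec y z))

/-- A poset is twin-free if it contains no twins. -/
def TwinFree {X : Type*} (prec : X → X → Prop) : Prop :=
  ∀ x y, ¬ Twins prec x y

/-- A unit OC interval order: unit intervals with left endpoint `g x`, open iff `o x`. -/
def UnitOCOrder {X : Type*} (prec : X → X → Prop) : Prop :=
  ∃ (g : X → ℝ) (o : X → Bool), ∀ x y,
    prec x y ↔ (g x + 1 < g y ∨ (g x + 1 = g y ∧ (o x = true ∨ o y = true)))

/-- `P` contains an induced copy of `Q`. -/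
def ContainsInduced {X : Type*} {Q : Type*} (prec : X → X → Prop) (qrel : Q → Q → Prop) : Prop :=
  ∃ f : Q → X, Function.Injective f ∧ ∀ a b, qrel a b ↔ prec (f a) (f b)

/-- The poset `2+2`: elements `a = 0, b = 1, p = 2, q = 3`; relations `a ≺ b`, `p ≺ q`. -/
def rel2p2 : Fin 4 → Fin 4 → Prop := fun i j =>
  (i = 0 ∧ j = 1) ∨ (i = 2 ∧ j = 3)

/-- The poset `3+1`: a chain `0 ≺ 1 ≺ 2` plus the isolated element `3`. -/
def rel3p1 : Fin 4 → Fin 4 → Prop := fun i j =>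
  (i : ℕ) < (j : ℕ) ∧ (j : ℕ) ≤ 2

/-- The poset `4+1`: a chain `0 ≺ 1 ≺ 2 ≺ 3` plus the isolated element `4`. -/
def rel4p1 : Fin 5 → Fin 5 → Prop := fun i j =>
  (i : ℕ) < (j : ℕ) ∧ (j : ℕ) ≤ 3

/-- The poset `3+1+1`: a chain `0 ≺ 1 ≺ 2` plus isolated elements `3, 4`. -/
def rel3p1p1 : Fin 5 → Fin 5 → Prop := fun i j =>
  (i : ℕ) < (j : ℕ) ∧ (j : ℕ) ≤ 2

/-- The poset `Z`: `x = 0, y = 1, z = 2, w = 3, u = 4, v = 5` with relations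
`x≺y, x≺z, x≺w, y≺z, y≺w, z≺w, x≺v, u≺w`. -/
def relZ : Fin 6 → Fin 6 → Prop := fun i j =>
  ((i : ℕ) < (j : ℕ) ∧ (j : ℕ) ≤ 3) ∨ (i = 0 ∧ j = 5) ∨ (i = 4 ∧ j = 3)

/-- The poset `D`: `x = 0, y = 1, w = 2, z = 3, v = 4` with relations
`x≺y, x≺w, x≺z, y≺z, w≺z`. -/
def relD : Fin 5 → Fin 5 → Prop := fun i j =>
  (i = 0 ∧ (j = 1 ∨ j = 2 ∨ j = 3)) ∨ ((i = 1 ∨ i = 2) ∧ j = 3)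

/-- The poset `Y`: `x = 0, y = 1, z = 2, w = 3, v = 4` with relations
`x≺y, x≺z, x≺w, y≺z, y≺w`. -/
def relY : Fin 5 → Fin 5 → Prop := fun i j =>
  (i = 0 ∧ (j = 1 ∨ j = 2 ∨ j = 3)) ∨ (i = 1 ∧ (j = 2 ∨ j = 3))

/-- The poset `H`: `x = 0, y = 1, z = 2, w = 3, u = 4, v = 5` with relations
`x≺y, x≺z, x≺w, y≺z, y≺w, z≺w, x≺u, y≺u, v≺z, v≺w`. -/
def relH : Fin 6 → Fin 6 → Prop := fun i j =>
  ((i : ℕ) < (j : ℕ) ∧ (j : ℕ) ≤ 3) ∨ ((i = 0 ∨ i = 1) ∧ j = 4) ∨ (i = 5 ∧ (j = 2 ∨ j = 3))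

/-- The poset `V`: `x = 0, b = 1, c = 2, d = 3, e = 4, f = 5` with relations
`x≺b, x≺c, x≺d, x≺e, b≺d, c≺e`. -/
def relV : Fin 6 → Fin 6 → Prop := fun i j =>
  (i = 0 ∧ (j = 1 ∨ j = 2 ∨ j = 3 ∨ j = 4)) ∨ (i = 1 ∧ j = 3) ∨ (i = 2 ∧ j = 4)

/-- A step of a forcing trail raises the center at least as much as it raises the value. -/
theorem SRep.center_sub_trailVal_le_succ {X : Type*} {prec : X → X → Prop} {S : Set IType}
    {c : X → ℝ} {τ : X → IType} (h : SRep prec S c τ) {x : ℕ → X} {i : ℕ}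
    (hi : prec (x i) (x (i + 1)) ∨ Incomp prec (x i) (x (i + 1))) :
    c (x i) - trailVal prec x i ≤ c (x (i + 1)) - trailVal prec x (i + 1) := by
  rw [trailVal, trailVal, Finset.sum_range_succ]
  split_ifs with hup
  · push_cast
    rcases (h.2 _ _).1 hup with hlt | ⟨heq, -⟩ <;> linarith
  · have hside := (hi.resolve_left hup).2
    rw [h.2] at hside
    push Not at hside
    push_cast
    linarith [hside.1]

/-- Along a forcing trail, center minus value is nondecreasing. -/
theorem SRep.center_sub_trailVal_mono {X : Type*} {prec : X → X → Prop} {S : Set IType}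
    {c : X → ℝ} {τ : X → IType} (h : SRep prec S c τ) {t : ℕ} {x : ℕ → X}
    (hx : ForcingTrail prec t x) {i j : ℕ} (hij : i ≤ j) (hj : j ≤ t) :
    c (x i) - trailVal prec x i ≤ c (x j) - trailVal prec x j := by
  induction j, hij using Nat.le_induction with
  | base => exact le_rfl
  | succ k _ ih =>
    exact (ih (by omega)).trans (h.center_sub_trailVal_le_succ (hx k (by omega)))

/-- on a value-0 forcing cycle, the centers of any `{A,B,C,D}`-representation
are determined: `c (x i) = c (x 0) + val (x i)`. -/
theorem stmt_5 {X : Type*} (prec : X → X → Prop)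
    (hirr : ∀ x, ¬ prec x x)
    (htrans : ∀ x y z, prec x y → prec y z → prec x z)
    (t : ℕ) (x : ℕ → X)
    (hx : ForcingTrail prec t x) (hcyc : x t = x 0)
    (hval : trailVal prec x t = 0)
    (c : X → ℝ) (τ : X → IType)
    (h : SRep prec Set.univ c τ) :
    ∀ i ≤ t, c (x i) = c (x 0) + (trailVal prec x i : ℝ) := by
  intro i hi
  have hlow := h.center_sub_trailVal_mono hx i.zero_le hi
  have hhigh := h.center_sub_trailVal_mono hx hi le_rfl
  have hzero : trailVal prec x 0 = 0 := by simp [trailVal]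
  rw [hcyc, hval] at hhigh
  rw [hzero] at hlow
  push_cast at hlow hhigh
  linarith
end

section
/- Let S be a nonempty subset of {A,B,C,D} and let P be a finite poset such that val(C) ≤ 0 for every forcing cycle C in P. Suppose further that for every forcing cycle C in P with val(C) = 0, the subposet of P induced on the set of elements appearing in C admits an S-representation. Then P admits an S-representation. -/
/-- There is a forcing trail from `x` to `y` of value `v` visiting every element of `s`. -/
def TrailVia {X : Type*} (prec : X → X → Prop) (x y : X) (v : ℤ) (s : Set X) : Prop :=
  ∃ (t : ℕ) (p : ℕ → X), ForcingTrail prec t p ∧ p 0 = x ∧ p t = y ∧ trailVal prec p t = v ∧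
    ∀ z ∈ s, ∃ i ≤ t, p i = z

section Trails

variable {X : Type*} {prec : X → X → Prop}

open scoped Classical in
theorem trailVal_succ (p : ℕ → X) (i : ℕ) :
    trailVal prec p (i + 1) = trailVal prec p i + if prec (p i) (p (i + 1)) then 1 else -1 :=
  Finset.sum_range_succ _ _

theorem trailVal_zero (p : ℕ → X) : trailVal prec p 0 = 0 := Finset.sum_range_zero _

theorem trailVal_add (p : ℕ → X) (i k : ℕ) :
    trailVal prec p (i + k) = trailVal prec p i + trailVal prec (fun j => p (i + j)) k :=
  Finset.sum_range_add _ _ _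

theorem trailVal_congr {p q : ℕ → X} {t : ℕ} (h : ∀ i ≤ t, p i = q i) :
    trailVal prec p t = trailVal prec q t := by
  refine Finset.sum_congr rfl fun i hi => ?_
  have hi := Finset.mem_range.1 hi
  rw [h i (by omega), h (i + 1) (by omega)]

theorem TrailVia.refl (x : X) : TrailVia prec x x 0 {x} :=
  ⟨0, fun _ => x, fun _ h => absurd h (Nat.not_lt_zero _), rfl, rfl, trailVal_zero _,
    fun _ hz => ⟨0, le_rfl, hz.symm⟩⟩

theorem TrailVia.mono {x y : X} {v : ℤ} {s s' : Set X} (h : TrailVia prec x y v s)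
    (hs : s' ⊆ s) : TrailVia prec x y v s' := by
  obtain ⟨t, p, h1, h2, h3, h4, h5⟩ := h
  exact ⟨t, p, h1, h2, h3, h4, fun z hz => h5 z (hs hz)⟩

theorem TrailVia.insert_target {x y : X} {v : ℤ} {s : Set X} (h : TrailVia prec x y v s) :
    TrailVia prec x y v (insert y s) := by
  obtain ⟨t, p, h1, h2, h3, h4, h5⟩ := h
  refine ⟨t, p, h1, h2, h3, h4, ?_⟩
  rintro z (rfl | hz)
  · exact ⟨t, le_rfl, h3⟩
  · exact h5 z hz

theorem TrailVia.trans {x y z : X} {v w : ℤ} {s s' : Set X} (h : TrailVia prec x y v s)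
    (h' : TrailVia prec y z w s') : TrailVia prec x z (v + w) (s ∪ s') := by
  obtain ⟨t, p, hp, rfl, hpt, rfl, hps⟩ := h
  obtain ⟨u, q, hq, hq0, rfl, rfl, hqs⟩ := h'
  let r : ℕ → X := fun i => if i ≤ t then p i else q (i - t)
  have hr1 : ∀ i ≤ t, r i = p i := fun i hi => if_pos hi
  have hr2 : ∀ j, r (t + j) = q j := by
    intro j
    rcases Nat.eq_zero_or_pos j with rfl | hj
    · rw [add_zero, hr1 t le_rfl, hpt, hq0]
    · have : ¬ t + j ≤ t := by omega
      simp [r, this]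
  refine ⟨t + u, r, ?_, hr1 0 (Nat.zero_le _), hr2 u, ?_, ?_⟩
  · intro i hi
    by_cases h : i < t
    · rw [hr1 i h.le, hr1 (i + 1) h]
      exact hp i h
    · obtain ⟨j, rfl⟩ := Nat.exists_eq_add_of_le (not_lt.1 h)
      rw [add_assoc, hr2, hr2]
      exact hq j (by omega)
  · rw [trailVal_add, trailVal_congr hr1, trailVal_congr fun j _ => hr2 j]
  · rintro z (hz | hz)
    · obtain ⟨i, hi, rfl⟩ := hps z hz
      exact ⟨i, by omega, hr1 i hi⟩
    · obtain ⟨i, hi, rfl⟩ := hqs z hz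
      exact ⟨t + i, by omega, hr2 i⟩

theorem TrailVia.of_step {x y : X} (h : prec x y ∨ Incomp prec x y) {v : ℤ}
    (hv : trailVal prec (fun i => if i = 0 then x else y) 1 = v) : TrailVia prec x y v ∅ := by
  refine ⟨1, fun i => if i = 0 then x else y, ?_, by simp, by simp, hv, by simp⟩
  intro i hi
  obtain rfl : i = 0 := by omega
  simpa using h

theorem TrailVia.of_prec {x y : X} (h : prec x y) : TrailVia prec x y 1 ∅ :=
  .of_step (.inl h) (by simp [trailVal, h])

theorem TrailVia.of_incomp {x y : X} (h : Incomp prec x y) : TrailVia prec x y (-1) ∅ :=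
  .of_step (.inr h) (by simp [trailVal, h.1])

theorem trailVal_le_of_revisit
    (hle : ∀ (t : ℕ) (x : ℕ → X), ForcingTrail prec t x → x t = x 0 → trailVal prec x t ≤ 0)
    {t : ℕ} {p : ℕ → X} (hp : ForcingTrail prec t p) {i j : ℕ} (hij : i ≤ j) (hj : j ≤ t)
    (h : p j = p i) : trailVal prec p j ≤ trailVal prec p i := by
  obtain ⟨k, rfl⟩ := Nat.exists_eq_add_of_le hij
  have := hle k (fun j => p (i + j)) (fun m hm => hp (i + m) (by omega)) (by simpa using h)
  rw [trailVal_add]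
  omega

theorem trailVal_lt_card [Finite X]
    (hle : ∀ (t : ℕ) (x : ℕ → X), ForcingTrail prec t x → x t = x 0 → trailVal prec x t ≤ 0)
    {t : ℕ} {p : ℕ → X} (hp : ForcingTrail prec t p) : trailVal prec p t < Nat.card X := by
  classical
  have key : ∀ j ≤ t, ∀ i ≤ j,
      trailVal prec p i < ((Finset.range (j + 1)).image p).card := by
    intro j
    induction j with
    | zero =>
      intro _ i hi
      obtain rfl : i = 0 := by omega
      simp [trailVal_zero]
    | succ j ih =>
      intro hj i hi
      have ih := ih (by omega)
      rw [Finset.range_add_one, Finset.image_insert]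
      rcases Nat.lt_or_ge i (j + 1) with hij | hij
      · have h1 := ih i (by omega)
        have h2 := Finset.card_le_card
          (Finset.subset_insert (p (j + 1)) ((Finset.range (j + 1)).image p))
        omega
      · obtain rfl : i = j + 1 := by omega
        by_cases hmem : p (j + 1) ∈ (Finset.range (j + 1)).image p
        · rw [Finset.insert_eq_of_mem hmem]
          obtain ⟨k, hk, hkp⟩ := Finset.mem_image.1 hmem
          have hk := Finset.mem_range.1 hk
          have := ih k (by omega)
          have := trailVal_le_of_revisit hle hp hk.le hj hkp.symm
          omega
        · rw [Finset.card_insert_of_notMem hmem, trailVal_succ]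
          have := ih j le_rfl
          split_ifs <;> push_cast <;> omega
  have h1 := key t le_rfl t le_rfl
  have h2 : ((Finset.range (t + 1)).image p).card ≤ Nat.card X := by
    have := Fintype.ofFinite X
    rw [Nat.card_eq_fintype_card]
    exact Finset.card_le_univ _
  omega

theorem exists_potential [Finite X]
    (hle : ∀ (t : ℕ) (x : ℕ → X), ForcingTrail prec t x → x t = x 0 → trailVal prec x t ≤ 0) :
    ∃ f : X → ℤ, (∀ x y, prec x y → f x + 1 ≤ f y) ∧
      ∀ x y, Incomp prec x y → f x - 1 ≤ f y := by
  have hmax : ∀ y, ∃ v, (∃ x, TrailVia prec x y v ∅) ∧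
      ∀ w, (∃ x, TrailVia prec x y w ∅) → w ≤ v := by
    intro y
    refine Int.exists_greatest_of_bdd ⟨Nat.card X, ?_⟩
      ⟨0, y, (TrailVia.refl y).mono (Set.empty_subset _)⟩
    rintro _ ⟨_, t, p, hp, _, _, rfl, _⟩
    exact (trailVal_lt_card hle hp).le
  choose f hf hfm using hmax
  refine ⟨f, fun x y h => ?_, fun x y h => ?_⟩
  · obtain ⟨z, hz⟩ := hf x
    exact hfm y _ ⟨z, (hz.trans (.of_prec h)).mono (Set.empty_subset _)⟩
  · obtain ⟨z, hz⟩ := hf x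
    exact hfm y _ ⟨z, (hz.trans (.of_incomp h)).mono (Set.empty_subset _)⟩

/-- A potential is tight along every closed forcing trail of value `0`. -/
theorem potential_eq_of_cycle {t : ℕ} {p : ℕ → X} (hp : ForcingTrail prec t p)
    (hv : trailVal prec p t = 0) {φ : ℕ → ℝ} (hφ : φ t = φ 0)
    (hup : ∀ i < t, prec (p i) (p (i + 1)) → φ i + 1 ≤ φ (i + 1))
    (hside : ∀ i < t, Incomp prec (p i) (p (i + 1)) → φ i - 1 ≤ φ (i + 1)) :
    ∀ i ≤ t, φ i = φ 0 + trailVal prec p i := by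
  have step : ∀ i < t, φ i - trailVal prec p i ≤ φ (i + 1) - trailVal prec p (i + 1) := by
    intro i hi
    rw [trailVal_succ]
    rcases hp i hi with h | h
    · have := hup i hi h
      rw [if_pos h]
      push_cast
      linarith
    · have := hside i hi h
      rw [if_neg h.1]
      push_cast
      linarith
  have mono : ∀ i j, i ≤ j → j ≤ t → φ i - trailVal prec p i ≤ φ j - trailVal prec p j := by
    intro i j hij
    induction j, hij using Nat.le_induction with
    | base => exact fun _ => le_rfl
    | succ j _ ih => exact fun hj => (ih (by omega)).trans (step j hj)
  intro i hi
  have h1 := mono 0 i (Nat.zero_le _) hi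
  have h2 := mono i t hi le_rfl
  rw [hv, hφ] at h2
  rw [trailVal_zero] at h1
  push_cast at h1 h2
  linarith

theorem SRep.add_one_le {S : Set IType} {c : X → ℝ} {τ : X → IType} (h : SRep prec S c τ)
    {x y : X} (hxy : prec x y) : c x + 1 ≤ c y := by
  rcases (h.2 x y).1 hxy with h | h
  · exact h.le
  · exact h.1.le

theorem SRep.sub_one_le {S : Set IType} {c : X → ℝ} {τ : X → IType} (h : SRep prec S c τ)
    {x y : X} (hxy : ¬ prec y x) : c x - 1 ≤ c y := by
  by_contra! hlt
  exact hxy ((h.2 y x).2 (.inl (by linarith)))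

/-- On the elements of a closed trail of value `0`, the centers of an `S`-representation can be
taken to be any potential. -/
theorem exists_types_of_cycle {S : Set IType} (hS : S.Nonempty)
    (h0 : ∀ (t : ℕ) (x : ℕ → X), ForcingTrail prec t x → x t = x 0 →
      trailVal prec x t = 0 →
      SOrder (fun (a b : {y : X // ∃ i ≤ t, x i = y}) => prec a.1 b.1) S)
    {f : X → ℤ} (hup : ∀ x y, prec x y → f x + 1 ≤ f y)
    (hside : ∀ x y, Incomp prec x y → f x - 1 ≤ f y) {x : X} {s : Set X}
    (hs : TrailVia prec x x 0 s) :
    ∃ τ : X → IType, (∀ a, τ a ∈ S) ∧ ∀ a ∈ s, ∀ b ∈ s,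
      (prec a b ↔ (f a + 1 < f b ∨ (f a + 1 = f b ∧ typeComp (τ a) (τ b)))) := by
  classical
  obtain ⟨t, p, hp, hp0, hpt, hv, hps⟩ := hs
  have hclosed : p t = p 0 := hpt.trans hp0.symm
  obtain ⟨c, τ, hc⟩ := h0 t p hp hclosed hv
  obtain ⟨s₀, hs₀⟩ := hS
  let e : X → ℝ := fun y => if h : ∃ i ≤ t, p i = y then c ⟨y, h⟩ else 0
  have he : ∀ y (h : ∃ i ≤ t, p i = y), e y = c ⟨y, h⟩ := fun y h => dif_pos h
  have hfp := potential_eq_of_cycle hp hv (φ := fun i => (f (p i) : ℝ)) (by simp only [hclosed])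
    (fun i _ h => by exact_mod_cast hup _ _ h) (fun i _ h => by exact_mod_cast hside _ _ h)
  have hcp := potential_eq_of_cycle hp hv (φ := fun i => e (p i)) (by simp only [hclosed])
    (fun i hi h => by
      simp only [he (p i) ⟨i, hi.le, rfl⟩, he (p (i + 1)) ⟨i + 1, hi, rfl⟩]
      exact hc.add_one_le h)
    (fun i hi h => by
      simp only [he (p i) ⟨i, hi.le, rfl⟩, he (p (i + 1)) ⟨i + 1, hi, rfl⟩]
      exact hc.sub_one_le h.2)
  have hce : ∀ y (h : ∃ i ≤ t, p i = y), c ⟨y, h⟩ = f y + (e (p 0) - f (p 0)) := by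
    intro y h
    rw [← he y h]
    obtain ⟨i, hi, rfl⟩ := h
    have h1 := hfp i hi
    have h2 := hcp i hi
    linarith
  refine ⟨fun y => if h : ∃ i ≤ t, p i = y then τ ⟨y, h⟩ else s₀, fun a => ?_, fun a ha b hb => ?_⟩
  · dsimp only
    split_ifs with h
    · exact hc.1 _
    · exact hs₀
  · have h := hc.2 ⟨a, hps a ha⟩ ⟨b, hps b hb⟩
    rw [hce, hce] at h
    simp only [dif_pos (hps a ha), dif_pos (hps b hb)]
    refine h.trans (or_congr ?_ (and_congr_left fun _ => ?_))
    · rw [add_right_comm, add_lt_add_iff_right]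
      exact_mod_cast Iff.rfl
    · rw [add_right_comm, add_left_inj]
      exact_mod_cast Iff.rfl

/-- There is a forcing trail from `x` to `y` along which the potential `f` is tight. -/
def TightReach (prec : X → X → Prop) (f : X → ℤ) (x y : X) : Prop :=
  TrailVia prec x y (f y - f x) ∅

theorem TightReach.refl (f : X → ℤ) (x : X) : TightReach prec f x x := by
  have := (TrailVia.refl (prec := prec) x).mono (Set.empty_subset _)
  rwa [TightReach, sub_self]

theorem TightReach.trans {f : X → ℤ} {x y z : X} (h : TightReach prec f x y)
    (h' : TightReach prec f y z) : TightReach prec f x z := by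
  have := TrailVia.trans h h'
  rwa [Set.union_empty, sub_add_sub_cancel'] at this

theorem exists_cycle_through_class [Finite X] (f : X → ℤ) (x : X) :
    TrailVia prec x x 0 {y | TightReach prec f x y ∧ TightReach prec f y x} := by
  refine Set.Finite.induction_on_subset
    (motive := fun s _ => TrailVia prec x x 0 s) _ (Set.toFinite _)
    ((TrailVia.refl x).mono (Set.empty_subset _)) ?_
  intro y s hy _ _ ih
  have := ih.trans ((TrailVia.insert_target hy.1).trans hy.2)
  rw [sub_add_sub_cancel, sub_self, add_zero] at this
  refine this.mono ?_
  rintro z (rfl | hz)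
  · exact .inr (.inl (.inl rfl))
  · exact .inl hz

/-- The number of elements from which `x` can be reached by a tight trail. -/
noncomputable def tightRank (prec : X → X → Prop) (f : X → ℤ) (x : X) : ℕ :=
  {z | TightReach prec f z x}.ncard

theorem tightRank_mono [Finite X] {f : X → ℤ} {x y : X} (h : TightReach prec f x y) :
    tightRank prec f x ≤ tightRank prec f y :=
  Set.ncard_le_ncard (fun _ hz => TightReach.trans hz h) (Set.toFinite _)

theorem tightRank_lt [Finite X] {f : X → ℤ} {x y : X} (h : TightReach prec f x y)
    (h' : ¬ TightReach prec f y x) : tightRank prec f x < tightRank prec f y := by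
  refine Set.ncard_lt_ncard ⟨fun _ hz => TightReach.trans hz h, fun hsub => h' ?_⟩ (Set.toFinite _)
  exact hsub (TightReach.refl f y)

theorem tightRank_le_card [Finite X] (f : X → ℤ) (x : X) :
    tightRank prec f x ≤ Nat.card X := by
  rw [← Set.ncard_univ]
  exact Set.ncard_le_ncard (Set.subset_univ _) (Set.toFinite _)

/-- The potential `f`, perturbed so that ties survive only inside tight classes. -/
noncomputable def perturbed (prec : X → X → Prop) (f : X → ℤ) (x : X) : ℝ :=
  f x + tightRank prec f x / (Nat.card X + 1)

theorem perturbed_lt [Finite X] {f : X → ℤ} {x y : X} {w : ℤ} (hw : f x + w ≤ f y)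
    (htight : TrailVia prec x y w ∅)
    (hxy : ¬ (TightReach prec f x y ∧ TightReach prec f y x)) :
    perturbed prec f x + w < perturbed prec f y := by
  have hN : (0 : ℝ) < Nat.card X + 1 := by positivity
  unfold perturbed
  rcases hw.eq_or_lt with h | h
  · obtain rfl : w = f y - f x := by omega
    have hlt : (tightRank prec f x : ℝ) < tightRank prec f y := by
      exact_mod_cast tightRank_lt htight fun h' => hxy ⟨htight, h'⟩
    have := div_lt_div_of_pos_right hlt hN
    push_cast
    linarith
  · have h1 : (tightRank prec f x : ℝ) / (Nat.card X + 1) < 1 := by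
      rw [div_lt_one hN]
      have : (tightRank prec f x : ℝ) ≤ Nat.card X := by exact_mod_cast tightRank_le_card f x
      linarith
    have h2 : (0 : ℝ) ≤ (tightRank prec f y : ℝ) / (Nat.card X + 1) := by positivity
    have h3 : (f x : ℝ) + w + 1 ≤ f y := by exact_mod_cast h
    linarith

end Trails

/-- if all forcing cycles have value ≤ 0 and, for every value-0 forcing cycle,
the induced subposet on its elements admits an `S`-representation, then the whole finite
poset admits an `S`-representation. -/
theorem stmt_6 {X : Type*} [Finite X] (prec : X → X → Prop)
    (hirr : ∀ x, ¬ prec x x)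
    (htrans : ∀ x y z, prec x y → prec y z → prec x z)
    (S : Set IType) (hS : S.Nonempty)
    (hle : ∀ (t : ℕ) (x : ℕ → X), ForcingTrail prec t x → x t = x 0 →
      trailVal prec x t ≤ 0)
    (h0 : ∀ (t : ℕ) (x : ℕ → X), ForcingTrail prec t x → x t = x 0 →
      trailVal prec x t = 0 →
      SOrder (fun (a b : {y : X // ∃ i ≤ t, x i = y}) => prec a.1 b.1) S) :
    SOrder prec S := by
  obtain ⟨f, hup, hside⟩ := exists_potential hle
  let K : X → Set X := fun x => {y | TightReach prec f x y ∧ TightReach prec f y x}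
  have hK : ∀ {x y}, y ∈ K x → K x = K y := by
    intro x y h
    ext z
    exact ⟨fun hz => ⟨h.2.trans hz.1, hz.2.trans h.1⟩, fun hz => ⟨h.1.trans hz.1, hz.2.trans h.2⟩⟩
  have htypes : ∀ L : Set X, ∃ τ : X → IType, L ∈ Set.range K → (∀ a, τ a ∈ S) ∧
      ∀ a ∈ L, ∀ b ∈ L,
        (prec a b ↔ (f a + 1 < f b ∨ (f a + 1 = f b ∧ typeComp (τ a) (τ b)))) := by
    intro L
    by_cases hL : L ∈ Set.range K
    · obtain ⟨x, rfl⟩ := hL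
      obtain ⟨τ, hτ⟩ :=
        exists_types_of_cycle hS h0 hup hside (exists_cycle_through_class f x)
      exact ⟨τ, fun _ => hτ⟩
    · exact ⟨fun _ => hS.some, fun h => absurd h hL⟩
  choose F hF using htypes
  refine ⟨perturbed prec f, fun x => F (K x) x, fun x => (hF _ ⟨x, rfl⟩).1 x, fun x y => ?_⟩
  by_cases hxy : TightReach prec f x y ∧ TightReach prec f y x
  · have hrank : tightRank prec f x = tightRank prec f y :=
      (tightRank_mono hxy.1).antisymm (tightRank_mono hxy.2)
    have hKy : K x = K y := hK hxy
    have h := (hF (K x) ⟨x, rfl⟩).2 x ⟨.refl f x, .refl f x⟩ y hxy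
    dsimp only
    rw [← hKy]
    refine h.trans (or_congr ?_ (and_congr_left fun _ => ?_))
    · rw [perturbed, perturbed, hrank, add_right_comm, add_lt_add_iff_right]
      exact_mod_cast Iff.rfl
    · rw [perturbed, perturbed, hrank, add_right_comm, add_left_inj]
      exact_mod_cast Iff.rfl
  · have hyx : ¬ (TightReach prec f y x ∧ TightReach prec f x y) := fun h => hxy h.symm
    by_cases h : prec x y
    · have := perturbed_lt (hup x y h) (.of_prec h) hxy
      push_cast at this
      exact iff_of_true h (.inl this)
    · have hlt : perturbed prec f y - 1 < perturbed prec f x := by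
        by_cases h' : prec y x
        · have := perturbed_lt (hup y x h') (.of_prec h') hyx
          push_cast at this
          linarith
        · have := perturbed_lt (hside y x ⟨h', h⟩) (.of_incomp ⟨h', h⟩) hyx
          push_cast at this
          linarith
      refine iff_of_false h ?_
      rintro (h1 | ⟨h1, -⟩) <;> linarith
end

section
/- Let P be a finite twin-free poset satisfying one of the following: (i) P admits a {C,D}-representation and contains no induced copy of 2+2; (ii) P admits an {A,B}-representation and contains no induced copy of H; (iii) P admits an {A,C}-representation and contains no induced copy of Z. Let C : v_0, v_1, …, v_n (with v_n = v_0 and n ≥ 1) be a forcing cycle in P with val(C) = 0. Then there exist a positive integer q and pairwise distinct elements x_0, x_2, …, x_{2q} and y_1, y_3, …, y_{2q−1} and z_1, z_3, …, z_{2q−1} of P such that the set {v_0, …, v_n} equals {x_i : i = 0,2,…,2q} ∪ {y_i : i = 1,3,…,2q−1} ∪ {z_i : i = 1,3,…,2q−1}, and for each step of the cycle (each j with 0 ≤ j ≤ n−1): if v_j ≺ v_{j+1} then the unordered pair {v_j, v_{j+1}} equals {x_i, y_{i+1}} or {y_i, x_{i+1}} for some i, and if v_j ∥ v_{j+1} then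 the unordered pair {v_j, v_{j+1}} equals {x_i, z_{i+1}} or {z_i, x_{i+1}} for some i. -/
/-- The step structure of a forcing cycle of value zero: `h` is the level of an element of the
visited set `W`, up-steps raise the level by one and side-steps lower it by one. -/
structure LeveledCycle {X : Type*} (prec : X → X → Prop) (h : X → ℕ) (W : Set X) : Prop where
  finite : W.Finite
  exists_zero : ∃ w ∈ W, h w = 0
  exists_next : ∀ w ∈ W, (∃ w' ∈ W, prec w w' ∧ h w' = h w + 1) ∨
    (∃ w' ∈ W, Incomp prec w w' ∧ h w = h w' + 1)
  exists_prev : ∀ w ∈ W, (∃ w' ∈ W, prec w' w ∧ h w = h w' + 1) ∨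
    (∃ w' ∈ W, Incomp prec w' w ∧ h w' = h w + 1)
  cross_up : ∀ a ∈ W, ∀ b ∈ W, ∀ k, h a ≤ k → k < h b →
    ∃ w ∈ W, ∃ w' ∈ W, prec w w' ∧ h w = k ∧ h w' = k + 1
  cross_side : ∀ a ∈ W, ∀ b ∈ W, ∀ k, h a ≤ k → k < h b →
    ∃ w ∈ W, ∃ w' ∈ W, Incomp prec w w' ∧ h w = k ∧ h w' = k + 1

theorem Incomp.symm {X : Type*} {prec : X → X → Prop} {x y : X} (h : Incomp prec x y) :
    Incomp prec y x := ⟨h.2, h.1⟩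

/-- A predicate preserved by every step of a closed walk holds everywhere once it holds once. -/
theorem forall_of_cyclic_invariant {X : Type*} {n : ℕ} {v : ℕ → X} (hcyc : v n = v 0)
    (P : X → Prop) (hP : ∀ j < n, P (v j) → P (v (j + 1))) {i : ℕ} (hi : i ≤ n) (h : P (v i)) :
    ∀ j ≤ n, P (v j) := by
  have mono : ∀ i ≤ n, P (v i) → ∀ j, i ≤ j → j ≤ n → P (v j) := by
    intro i _ h j hij
    induction j, hij using Nat.le_induction with
    | base => exact fun _ => h
    | succ j _ ih => exact fun hj => hP j hj (ih (by omega))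
  have h0 : P (v 0) := hcyc ▸ mono i hi h n hi le_rfl
  exact fun j hj => mono 0 (Nat.zero_le _) h0 j (Nat.zero_le _) hj

theorem leveledCycle_of_steps {X : Type*} {prec : X → X → Prop} {n : ℕ} {v : ℕ → X} (hn : 1 ≤ n)
    (hcyc : v n = v 0) {h : X → ℕ} (hzero : ∃ j ≤ n, h (v j) = 0)
    (hstep : ∀ j < n, (prec (v j) (v (j + 1)) ∧ h (v (j + 1)) = h (v j) + 1) ∨
      (Incomp prec (v j) (v (j + 1)) ∧ h (v j) = h (v (j + 1)) + 1)) :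
    LeveledCycle prec h {w | ∃ j ≤ n, v j = w} where
  finite := (Set.finite_Iic n).image v
  exists_zero := by
    obtain ⟨j, hj, h0⟩ := hzero
    exact ⟨v j, ⟨j, hj, rfl⟩, h0⟩
  exists_next := by
    rintro _ ⟨j, hj, rfl⟩
    obtain ⟨i, hi, e⟩ : ∃ i < n, v j = v i := by
      rcases hj.lt_or_eq with hj | rfl
      · exact ⟨j, hj, rfl⟩
      · exact ⟨0, hn, hcyc⟩
    rw [e]
    rcases hstep i hi with hs | hs
    · exact Or.inl ⟨v (i + 1), ⟨i + 1, hi, rfl⟩, hs⟩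
    · exact Or.inr ⟨v (i + 1), ⟨i + 1, hi, rfl⟩, hs⟩
  exists_prev := by
    rintro _ ⟨j, hj, rfl⟩
    obtain ⟨i, hi, e⟩ : ∃ i < n, v j = v (i + 1) := by
      rcases j with _ | j
      · exact ⟨n - 1, by omega, by rw [Nat.sub_add_cancel hn, hcyc]⟩
      · exact ⟨j, hj, rfl⟩
    rw [e]
    rcases hstep i hi with hs | hs
    · exact Or.inl ⟨v i, ⟨i, hi.le, rfl⟩, hs⟩
    · exact Or.inr ⟨v i, ⟨i, hi.le, rfl⟩, hs⟩
  cross_up := by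
    rintro _ ⟨i, hi, rfl⟩ _ ⟨j, hj, rfl⟩ k hik hjk
    by_contra hcon
    refine absurd (forall_of_cyclic_invariant hcyc (fun x => h x ≤ k) ?_ hi hik j hj) (by omega)
    intro l hl hlk
    rcases hstep l hl with hs | hs
    · by_contra hgt
      exact hcon ⟨v l, ⟨l, hl.le, rfl⟩, v (l + 1), ⟨l + 1, hl, rfl⟩, hs.1, by omega, by omega⟩
    · omega
  cross_side := by
    rintro _ ⟨i, hi, rfl⟩ _ ⟨j, hj, rfl⟩ k hik hjk
    by_contra hcon
    refine absurd (forall_of_cyclic_invariant hcyc (fun x => k < h x) ?_ hj hjk i hi) (by omega)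
    intro l hl hlk
    rcases hstep l hl with hs | hs
    · omega
    · by_contra hgt
      exact hcon ⟨v (l + 1), ⟨l + 1, hl, rfl⟩, v l, ⟨l, hl.le, rfl⟩, hs.1.symm,
        by omega, by omega⟩

/-- If no level has three elements and no two consecutive levels have two elements each, then
the levels alternate between one element and two elements, starting and ending with one. -/
theorem LeveledCycle.exists_alternating {X : Type*} {prec : X → X → Prop} {h : X → ℕ} {W : Set X}
    (H : LeveledCycle prec h W)
    (two : ∀ a ∈ W, ∀ b ∈ W, ∀ d ∈ W, h a = h b → h a = h d → a = b ∨ a = d ∨ b = d)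
    (nn : ∀ a ∈ W, ∀ b ∈ W, ∀ a' ∈ W, ∀ b' ∈ W, h a = h b → h a' = h a + 1 → h b' = h a + 1 →
      a = b ∨ a' = b') :
    ∃ q : ℕ, 0 < q ∧ ∃ xe ye ze : ℕ → X,
      (∀ w ∈ W, h w ≤ 2 * q) ∧
      (∀ i ≤ q, xe i ∈ W ∧ h (xe i) = 2 * i ∧ ∀ w ∈ W, h w = 2 * i → w = xe i) ∧
      (∀ i < q, ye i ∈ W ∧ ze i ∈ W ∧ h (ye i) = 2 * i + 1 ∧ h (ze i) = 2 * i + 1 ∧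
        (∀ w ∈ W, h w = 2 * i + 1 → w = ye i ∨ w = ze i) ∧
        prec (xe i) (ye i) ∧ Incomp prec (xe i) (ze i) ∧
        prec (ye i) (xe (i + 1)) ∧ Incomp prec (ze i) (xe (i + 1))) := by
  obtain ⟨s, hs, hs0⟩ := H.exists_zero
  obtain ⟨t, ht, hmax⟩ := Set.exists_max_image W h H.finite ⟨s, hs⟩
  have uniq : ∀ k, 2 * k ≤ h t → ∀ a ∈ W, ∀ b ∈ W, h a = 2 * k → h b = 2 * k → a = b := by
    intro k
    induction k with
    | zero =>
      intro _ a ha b hb ha0 hb0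
      obtain ⟨p, hp, hap, hph⟩ : ∃ p ∈ W, prec a p ∧ h p = h a + 1 := by
        rcases H.exists_next a ha with hh | ⟨p, _, _, hp⟩
        · exact hh
        · omega
      obtain ⟨r, hr, har, hrh⟩ : ∃ r ∈ W, Incomp prec r a ∧ h r = h a + 1 := by
        rcases H.exists_prev a ha with ⟨p, _, _, hp⟩ | hh
        · omega
        · exact hh
      rcases nn a ha b hb p hp r hr (by omega) hph hrh with e | rfl
      · exact e
      · exact absurd hap har.2
    | succ k ih =>
      intro hk a ha b hb hak hbk
      obtain ⟨w, hw, w', hw', hww, hwk, hwk'⟩ := H.cross_up s hs t ht (2 * k) (by omega) (by omega)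
      obtain ⟨u, hu, u', hu', huu, huk, huk'⟩ :=
        H.cross_side s hs t ht (2 * k) (by omega) (by omega)
      obtain rfl := ih (by omega) w hw u hu hwk huk
      rcases nn w' hw' u' hu' a ha b hb (by omega) (by omega) (by omega) with rfl | e
      · exact absurd hww huu.1
      · exact e
  obtain ⟨q, hq⟩ : ∃ q, h t = 2 * q := by
    rcases Nat.even_or_odd' (h t) with ⟨q, hq | hq⟩
    · exact ⟨q, hq⟩
    · obtain ⟨w, hw, w', hw', hww, hwk, hwk'⟩ :=
        H.cross_up s hs t ht (2 * q) (by omega) (by omega)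
      rcases H.exists_next w' hw' with ⟨u, hu, _, hu'⟩ | ⟨u, hu, huw, hu'⟩
      · have := hmax u hu
        omega
      · obtain rfl := uniq q (by omega) w hw u hu hwk (by omega)
        exact absurd hww huw.2
  have hq0 : 0 < q := by
    rcases H.exists_next s hs with ⟨u, hu, _, hu'⟩ | ⟨u, hu, _, hu'⟩
    · have := hmax u hu
      omega
    · omega
  have hx : ∀ i, ∃ x, i ≤ q → x ∈ W ∧ h x = 2 * i := by
    intro i
    by_cases hi : i < q
    · obtain ⟨w, hw, _, _, _, hwk, _⟩ := H.cross_up s hs t ht (2 * i) (by omega) (by omega)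
      exact ⟨w, fun _ => ⟨hw, hwk⟩⟩
    · exact ⟨t, fun _ => ⟨ht, by omega⟩⟩
  choose xe hxe using hx
  have hxu : ∀ i ≤ q, ∀ w ∈ W, h w = 2 * i → w = xe i := fun i hi w hw hwi =>
    uniq i (by omega) w hw (xe i) (hxe i hi).1 hwi (hxe i hi).2
  have hy : ∀ i, ∃ y, i < q → y ∈ W ∧ h y = 2 * i + 1 ∧ prec (xe i) y := by
    intro i
    by_cases hi : i < q
    · obtain ⟨w, hw, w', hw', hww, hwk, hwk'⟩ :=
        H.cross_up s hs t ht (2 * i) (by omega) (by omega)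
      exact ⟨w', fun _ => ⟨hw', hwk', hxu i hi.le w hw hwk ▸ hww⟩⟩
    · exact ⟨t, fun hi' => absurd hi' hi⟩
  have hz : ∀ i, ∃ z, i < q → z ∈ W ∧ h z = 2 * i + 1 ∧ Incomp prec (xe i) z := by
    intro i
    by_cases hi : i < q
    · obtain ⟨w, hw, w', hw', hww, hwk, hwk'⟩ :=
        H.cross_side s hs t ht (2 * i) (by omega) (by omega)
      exact ⟨w', fun _ => ⟨hw', hwk', hxu i hi.le w hw hwk ▸ hww⟩⟩
    · exact ⟨t, fun hi' => absurd hi' hi⟩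
  choose ye hye using hy
  choose ze hze using hz
  refine ⟨q, hq0, xe, ye, ze, fun w hw => hq ▸ hmax w hw,
    fun i hi => ⟨(hxe i hi).1, (hxe i hi).2, hxu i hi⟩, fun i hi => ?_⟩
  obtain ⟨hyW, hyh, hxy⟩ := hye i hi
  obtain ⟨hzW, hzh, hxz⟩ := hze i hi
  refine ⟨hyW, hzW, hyh, hzh, fun w hw hwi => ?_, hxy, hxz, ?_, ?_⟩
  · rcases two w hw _ hyW _ hzW (by omega) (by omega) with e | e | e
    · exact Or.inl e
    · exact Or.inr e
    · exact absurd (e ▸ hxy) hxz.1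
  · rcases H.exists_next _ hyW with ⟨u, hu, huy, hu'⟩ | ⟨u, hu, huy, hu'⟩
    · exact hxu (i + 1) hi u hu (by omega) ▸ huy
    · rw [hxu i hi.le u hu (by omega)] at huy
      exact absurd hxy huy.2
  · rcases H.exists_prev _ hzW with ⟨u, hu, huz, hu'⟩ | ⟨u, hu, huz, hu'⟩
    · rw [hxu i hi.le u hu (by omega)] at huz
      exact absurd huz hxz.1
    · exact hxu (i + 1) hi u hu (by omega) ▸ huz.symm

section Representation

variable {X : Type*} {prec : X → X → Prop} {S : Set IType} {c : X → ℝ} {τ : X → IType}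

theorem SRep.eq_of_twinFree (hrep : SRep prec S c τ) (htf : TwinFree prec) {a b : X}
    (hc : c a = c b) (ht : τ a = τ b) : a = b := by
  by_contra hab
  refine htf a b ⟨hab, ⟨?_, ?_⟩, fun z _ _ => ⟨?_, ?_⟩⟩
  · rw [hrep.2, hc]
    rintro (h | ⟨h, -⟩) <;> linarith
  · rw [hrep.2, hc]
    rintro (h | ⟨h, -⟩) <;> linarith
  · rw [hrep.2, hrep.2, hc, ht]
  · rw [hrep.2, hrep.2, hc, ht]

/-- Elements at integer offsets from a common base realise the poset read off from the offsets
and the types. -/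
theorem SRep.containsInduced (hrep : SRep prec S c τ) {m : ℕ} {qrel : Fin m → Fin m → Prop}
    (f : Fin m → X) (k : Fin m → ℕ) (t : Fin m → IType) {c₀ : ℝ}
    (hc : ∀ i, c (f i) = c₀ + k i) (ht : ∀ i, τ (f i) = t i)
    (hinj : ∀ i j, k i = k j → t i = t j → i = j)
    (hrel : ∀ i j, qrel i j ↔ (k i + 1 < k j ∨ (k i + 1 = k j ∧ typeComp (t i) (t j)))) :
    ContainsInduced prec qrel := by
  refine ⟨f, fun i j hij => hinj i j ?_ ?_, fun i j => ?_⟩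
  · have h1 := hc i
    rw [hij, hc j] at h1
    exact_mod_cast (add_left_cancel h1).symm
  · rw [← ht, ← ht, hij]
  · rw [hrel, hrep.2, hc, hc, ht, ht, add_assoc, add_lt_add_iff_left, add_right_inj]
    norm_cast

/-- In a cycle of value zero every step is tight, so centers are determined by partial values. -/
theorem SRep.center_eq_add_trailVal (hrep : SRep prec S c τ) {n : ℕ} {v : ℕ → X}
    (hv : ForcingTrail prec n v) (hcyc : v n = v 0) (hval : trailVal prec v n = 0) :
    ∀ j ≤ n, c (v j) = c (v 0) + trailVal prec v j := by
  have hmono : ∀ j < n, c (v j) - trailVal prec v j ≤ c (v (j + 1)) - trailVal prec v (j + 1) := by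
    intro j hj
    by_cases hp : prec (v j) (v (j + 1))
    · have h1 : trailVal prec v (j + 1) = trailVal prec v j + 1 := by
        simp [trailVal, Finset.sum_range_succ, hp]
      rw [h1]
      push_cast
      rcases (hrep.2 _ _).1 hp with h | ⟨h, -⟩ <;> linarith
    · have h1 : trailVal prec v (j + 1) = trailVal prec v j - 1 := by
        simp [trailVal, Finset.sum_range_succ, hp, sub_eq_add_neg]
      have h2 := ((hv j hj).resolve_left hp).2
      rw [hrep.2, not_or, not_lt] at h2
      rw [h1]
      push_cast
      linarith [h2.1]
  have key : ∀ i j, i ≤ j → j ≤ n →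
      c (v i) - trailVal prec v i ≤ c (v j) - trailVal prec v j := by
    intro i j hij
    induction j, hij using Nat.le_induction with
    | base => exact fun _ => le_rfl
    | succ j _ ih => exact fun hj => (ih (by omega)).trans (hmono j hj)
  intro j hj
  have h1 := key 0 j (Nat.zero_le _) hj
  have h2 := key j n hj le_rfl
  have h0 : trailVal prec v 0 = 0 := by simp [trailVal]
  rw [hcyc, hval] at h2
  rw [h0] at h1
  push_cast at h1 h2
  linarith

theorem SRep.exists_level (hrep : SRep prec S c τ) {n : ℕ} {v : ℕ → X} (hn : 1 ≤ n)
    (hv : ForcingTrail prec n v) (hcyc : v n = v 0) (hval : trailVal prec v n = 0) :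
    ∃ (h : X → ℕ) (c₀ : ℝ), LeveledCycle prec h {w | ∃ j ≤ n, v j = w} ∧
      (∀ w, (∃ j ≤ n, v j = w) → c w = c₀ + h w) ∧
      ∀ j < n, (prec (v j) (v (j + 1)) ∧ h (v (j + 1)) = h (v j) + 1) ∨
        (Incomp prec (v j) (v (j + 1)) ∧ h (v j) = h (v (j + 1)) + 1) := by
  have hc := hrep.center_eq_add_trailVal hv hcyc hval
  obtain ⟨m, hm, hmin⟩ := Set.exists_min_image (Set.Iic n) (trailVal prec v) (Set.finite_Iic n)
    ⟨0, Nat.zero_le n⟩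
  let h : X → ℕ := fun x => ⌊c x - c (v m)⌋₊
  have hh : ∀ j ≤ n, (h (v j) : ℤ) = trailVal prec v j - trailVal prec v m := by
    intro j hj
    have e : c (v j) - c (v m) = ((trailVal prec v j - trailVal prec v m).toNat : ℝ) := by
      have h1 : ((trailVal prec v j - trailVal prec v m).toNat : ℤ) =
        trailVal prec v j - trailVal prec v m := Int.toNat_of_nonneg (sub_nonneg.2 (hmin j hj))
      have h2 : ((trailVal prec v j - trailVal prec v m).toNat : ℝ) =
        trailVal prec v j - trailVal prec v m := by exact_mod_cast congrArg (Int.cast (R := ℝ)) h1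
      rw [h2, hc j hj, hc m hm]
      ring
    simp only [h]
    rw [e, Nat.floor_natCast]
    exact Int.toNat_of_nonneg (sub_nonneg.2 (hmin j hj))
  have hstep : ∀ j < n, (prec (v j) (v (j + 1)) ∧ h (v (j + 1)) = h (v j) + 1) ∨
      (Incomp prec (v j) (v (j + 1)) ∧ h (v j) = h (v (j + 1)) + 1) := by
    intro j hj
    have h1 := hh j hj.le
    have h2 := hh (j + 1) hj
    by_cases hp : prec (v j) (v (j + 1))
    · have h3 : trailVal prec v (j + 1) = trailVal prec v j + 1 := by
        simp [trailVal, Finset.sum_range_succ, hp]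
      exact Or.inl ⟨hp, by omega⟩
    · have h3 : trailVal prec v (j + 1) = trailVal prec v j - 1 := by
        simp [trailVal, Finset.sum_range_succ, hp, sub_eq_add_neg]
      exact Or.inr ⟨(hv j hj).resolve_left hp, by omega⟩
  refine ⟨h, c (v m), leveledCycle_of_steps hn hcyc ⟨m, hm, ?_⟩ hstep, ?_, hstep⟩
  · have := hh m hm
    omega
  · rintro _ ⟨j, hj, rfl⟩
    have h1 : ((h (v j) : ℤ) : ℝ) = ((trailVal prec v j - trailVal prec v m : ℤ) : ℝ) :=
      congrArg _ (hh j hj)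
    push_cast at h1
    rw [h1, hc j hj, hc m hm]
    ring

theorem SRep.prec_iff_of_succ (hrep : SRep prec S c τ) {x y : X} (h : c x + 1 = c y) :
    prec x y ↔ typeComp (τ x) (τ y) := by
  simp [hrep.2, h]

variable {h : X → ℕ} {W : Set X} {c₀ : ℝ}

theorem SRep.not_double_CD (hrep : SRep prec {IType.C, IType.D} c τ)
    (hfree : ¬ ContainsInduced prec rel2p2) (hc : ∀ w ∈ W, c w = c₀ + h w)
    {a b a' b' : X} (ha : a ∈ W) (hb : b ∈ W) (ha' : a' ∈ W) (hb' : b' ∈ W)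
    (hab : h a = h b) (haa : h a' = h a + 1) (hbb : h b' = h a + 1)
    (ta : τ a = IType.C) (tb : τ b = IType.D) (ta' : τ a' = IType.C) (tb' : τ b' = IType.D) :
    False := by
  refine hfree (hrep.containsInduced ![a, a', b, b'] ![0, 1, 0, 1]
    ![IType.C, IType.C, IType.D, IType.D] (c₀ := c₀ + h a) ?_ ?_ (by decide) ?_)
  · simp [Fin.forall_fin_succ, hc _ ha, hc _ hb, hc _ ha', hc _ hb', hab, haa, hbb, add_assoc]
  · simp [Fin.forall_fin_succ, ta, tb, ta', tb']
  · unfold rel2p2 typeComp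
    decide

theorem LeveledCycle.not_double_AB (H : LeveledCycle prec h W)
    (hrep : SRep prec {IType.A, IType.B} c τ)
    (hfree : ¬ ContainsInduced prec relH) (hc : ∀ w ∈ W, c w = c₀ + h w)
    {a b a' b' : X} (ha : a ∈ W) (hb : b ∈ W) (ha' : a' ∈ W) (hb' : b' ∈ W)
    (hab : h a = h b) (haa : h a' = h a + 1) (hbb : h b' = h a + 1)
    (ta : τ a = IType.A) (tb : τ b = IType.B) (ta' : τ a' = IType.A) (tb' : τ b' = IType.B) :
    False := by
  have hsucc : ∀ x ∈ W, ∀ y ∈ W, h y = h x + 1 → c x + 1 = c y := by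
    intro x hx y hy hxy
    rw [hc x hx, hc y hy, hxy]
    push_cast
    ring
  have side : ∀ x ∈ W, ∀ y ∈ W, h y = h x + 1 → Incomp prec x y →
      τ x = IType.A ∧ τ y = IType.A := by
    intro x hx y hy hxy hi
    have h1 := hi.1
    rw [hrep.prec_iff_of_succ (hsucc x hx y hy hxy)] at h1
    have h2 := hrep.1 x
    have h3 := hrep.1 y
    simp only [Set.mem_insert_iff, Set.mem_singleton_iff, typeComp] at h1 h2 h3
    tauto
  obtain ⟨r, hr, hrb⟩ : ∃ r ∈ W, h b = h r + 1 := by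
    rcases H.exists_prev b hb with ⟨r, hr, _, hh⟩ | ⟨r, hr, hi, hh⟩
    · exact ⟨r, hr, hh⟩
    · simpa [tb] using (side b hb r hr hh hi.symm).1
  obtain ⟨s, hs, hsb⟩ : ∃ s ∈ W, h s = h b' + 1 := by
    rcases H.exists_next b' hb' with ⟨r, hr, _, hh⟩ | ⟨r, hr, hi, hh⟩
    · exact ⟨r, hr, hh⟩
    · simpa [tb'] using (side r hr b' hb' hh hi.symm).2
  obtain ⟨x, hx, x', hx', hxx, hxr, hxr'⟩ := H.cross_side r hr b hb (h r) le_rfl (by omega)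
  obtain ⟨w', hw', w, hw, hww, hws', hws⟩ := H.cross_side b' hb' s hs (h b') le_rfl (by omega)
  have tx := (side x hx x' hx' (by omega) hxx).1
  have tw := (side w' hw' w hw (by omega) hww).2
  have ea : h a = h x + 1 := by omega
  have eb : h b = h x + 1 := by omega
  have ea' : h a' = h x + 2 := by omega
  have eb' : h b' = h x + 2 := by omega
  have ew : h w = h x + 3 := by omega
  refine hfree (hrep.containsInduced ![x, b, b', w, a', a] ![0, 1, 2, 3, 2, 1]
    ![IType.A, IType.B, IType.B, IType.A, IType.A, IType.A] (c₀ := c₀ + h x) ?_ ?_ (by decide) ?_)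
  · simp [Fin.forall_fin_succ, hc _ ha, hc _ hb, hc _ ha', hc _ hb', hc _ hx, hc _ hw,
      ea, eb, ea', eb', ew, add_assoc]
  · simp [Fin.forall_fin_succ, ta, tb, ta', tb', tx, tw]
  · unfold relH typeComp
    decide

theorem LeveledCycle.not_double_AC (H : LeveledCycle prec h W)
    (hrep : SRep prec {IType.A, IType.C} c τ)
    (hfree : ¬ ContainsInduced prec relZ) (hc : ∀ w ∈ W, c w = c₀ + h w)
    {a b a' b' : X} (ha : a ∈ W) (hb : b ∈ W) (ha' : a' ∈ W) (hb' : b' ∈ W)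
    (hab : h a = h b) (haa : h a' = h a + 1) (hbb : h b' = h a + 1)
    (ta : τ a = IType.A) (tb : τ b = IType.C) (ta' : τ a' = IType.A) (tb' : τ b' = IType.C) :
    False := by
  have hsucc : ∀ x ∈ W, ∀ y ∈ W, h y = h x + 1 → c x + 1 = c y := by
    intro x hx y hy hxy
    rw [hc x hx, hc y hy, hxy]
    push_cast
    ring
  have up : ∀ x ∈ W, ∀ y ∈ W, h y = h x + 1 → prec x y → τ x = IType.C ∧ τ y = IType.C := by
    intro x hx y hy hxy h1
    rw [hrep.prec_iff_of_succ (hsucc x hx y hy hxy)] at h1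
    have h2 := hrep.1 x
    have h3 := hrep.1 y
    simp only [Set.mem_insert_iff, Set.mem_singleton_iff, typeComp] at h1 h2 h3
    rcases h2 with h2 | h2 <;> rcases h3 with h3 | h3 <;> simp_all
  obtain ⟨r, hr, hra⟩ : ∃ r ∈ W, h a = h r + 1 := by
    rcases H.exists_next a ha with ⟨r, hr, hp, hh⟩ | ⟨r, hr, _, hh⟩
    · simpa [ta] using (up a ha r hr hh hp).1
    · exact ⟨r, hr, hh⟩
  obtain ⟨s, hs, hsa⟩ : ∃ s ∈ W, h s = h a' + 1 := by
    rcases H.exists_prev a' ha' with ⟨r, hr, hp, hh⟩ | ⟨r, hr, _, hh⟩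
    · simpa [ta'] using (up r hr a' ha' hh hp).2
    · exact ⟨r, hr, hh⟩
  obtain ⟨x, hx, x', hx', hxx, hxr, hxr'⟩ := H.cross_up r hr a ha (h r) le_rfl (by omega)
  obtain ⟨w', hw', w, hw, hww, hws', hws⟩ := H.cross_up a' ha' s hs (h a') le_rfl (by omega)
  have tx := (up x hx x' hx' (by omega) hxx).1
  have tw := (up w' hw' w hw (by omega) hww).2
  have ea : h a = h x + 1 := by omega
  have eb : h b = h x + 1 := by omega
  have ea' : h a' = h x + 2 := by omega
  have eb' : h b' = h x + 2 := by omega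
  have ew : h w = h x + 3 := by omega
  refine hfree (hrep.containsInduced ![x, b, b', w, a, a'] ![0, 1, 2, 3, 1, 2]
    ![IType.C, IType.C, IType.C, IType.C, IType.A, IType.A] (c₀ := c₀ + h x) ?_ ?_ (by decide) ?_)
  · simp [Fin.forall_fin_succ, hc _ ha, hc _ hb, hc _ ha', hc _ hb', hc _ hx, hc _ hw,
      ea, eb, ea', eb', ew, add_assoc]
  · simp [Fin.forall_fin_succ, ta, tb, ta', tb', tx, tw]
  · unfold relZ typeComp
    decide

/-- With only two types available, levels of a twin-free poset have at most two elements, and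
excluding one configuration of types excludes two consecutive two-element levels. -/
theorem SRep.level_bounds {s t : IType} (hrep : SRep prec {s, t} c τ)
    (htf : TwinFree prec) (hc : ∀ w ∈ W, c w = c₀ + h w)
    (hno : ∀ a ∈ W, ∀ b ∈ W, ∀ a' ∈ W, ∀ b' ∈ W, h a = h b → h a' = h a + 1 → h b' = h a + 1 →
      τ a = s → τ b = t → τ a' = s → τ b' = t → False) :
    (∀ a ∈ W, ∀ b ∈ W, ∀ d ∈ W, h a = h b → h a = h d → a = b ∨ a = d ∨ b = d) ∧
    (∀ a ∈ W, ∀ b ∈ W, ∀ a' ∈ W, ∀ b' ∈ W, h a = h b → h a' = h a + 1 → h b' = h a + 1 →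
      a = b ∨ a' = b') := by
  have inj : ∀ a ∈ W, ∀ b ∈ W, h a = h b → τ a = τ b → a = b := fun a ha b hb hab ht =>
    hrep.eq_of_twinFree htf (by rw [hc a ha, hc b hb, hab]) ht
  have ty : ∀ a, τ a = s ∨ τ a = t := fun a => by simpa using hrep.1 a
  constructor
  · intro a ha b hb d hd hab had
    have h1 := inj a ha b hb hab
    have h2 := inj a ha d hd had
    have h3 := inj b hb d hd (hab.symm.trans had)
    rcases ty a with ea | ea <;> rcases ty b with eb | eb <;> rcases ty d with ed | ed <;>
      simp_all
  · intro a ha b hb a' ha' b' hb' hab haa hbb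
    by_contra! hne
    have h1 := fun e => hne.1 (inj a ha b hb hab e)
    have h2 := fun e => hne.2 (inj a' ha' b' hb' (haa.trans hbb.symm) e)
    rcases ty a with ea | ea <;> rcases ty b with eb | eb <;>
      rcases ty a' with ea' | ea' <;> rcases ty b' with eb' | eb' <;>
      first
      | exact h1 (ea.trans eb.symm)
      | exact h2 (ea'.trans eb'.symm)
      | exact hno a ha b hb a' ha' b' hb' hab haa hbb ea eb ea' eb'
      | exact hno b hb a ha a' ha' b' hb' hab.symm (by omega) (by omega) eb ea ea' eb'
      | exact hno a ha b hb b' hb' a' ha' hab hbb haa ea eb eb' ea'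
      | exact hno b hb a ha b' hb' a' ha' hab.symm (by omega) (by omega) eb ea eb' ea'

end Representation

/-- structure of value-0 forcing cycles in certain twin-free `S`-orders.
Here `xe k, ye k, ze k` play the roles of `x_{2k}, y_{2k+1}, z_{2k+1}` of the paper. -/
theorem stmt_13 {X : Type*} [Finite X] (prec : X → X → Prop)
    (hirr : ∀ x, ¬ prec x x)
    (htrans : ∀ x y z, prec x y → prec y z → prec x z)
    (htf : TwinFree prec)
    (hcase :
      (SOrder prec {IType.C, IType.D} ∧ ¬ ContainsInduced prec rel2p2) ∨
      (SOrder prec {IType.A, IType.B} ∧ ¬ ContainsInduced prec relH) ∨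
      (SOrder prec {IType.A, IType.C} ∧ ¬ ContainsInduced prec relZ))
    (n : ℕ) (v : ℕ → X) (hn : 1 ≤ n)
    (hv : ForcingTrail prec n v) (hcyc : v n = v 0)
    (hval : trailVal prec v n = 0) :
    ∃ q : ℕ, 0 < q ∧ ∃ xe ye ze : ℕ → X,
      (∀ i ≤ q, ∀ j ≤ q, xe i = xe j → i = j) ∧
      (∀ i < q, ∀ j < q, ye i = ye j → i = j) ∧
      (∀ i < q, ∀ j < q, ze i = ze j → i = j) ∧
      (∀ i ≤ q, ∀ j < q, xe i ≠ ye j) ∧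
      (∀ i ≤ q, ∀ j < q, xe i ≠ ze j) ∧
      (∀ i < q, ∀ j < q, ye i ≠ ze j) ∧
      ({w : X | ∃ j ≤ n, v j = w} =
        {w : X | (∃ i ≤ q, xe i = w) ∨ (∃ i < q, ye i = w) ∨ (∃ i < q, ze i = w)}) ∧
      (∀ j < n, prec (v j) (v (j + 1)) →
        ∃ k < q, ({v j, v (j + 1)} : Set X) = {xe k, ye k} ∨
          ({v j, v (j + 1)} : Set X) = {ye k, xe (k + 1)}) ∧
      (∀ j < n, Incomp prec (v j) (v (j + 1)) →
        ∃ k < q, ({v j, v (j + 1)} : Set X) = {xe k, ze k} ∨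
          ({v j, v (j + 1)} : Set X) = {ze k, xe (k + 1)}) := by
  obtain ⟨h, H, hstep, two, nn⟩ : ∃ h : X → ℕ,
      LeveledCycle prec h {w | ∃ j ≤ n, v j = w} ∧
      (∀ j < n, (prec (v j) (v (j + 1)) ∧ h (v (j + 1)) = h (v j) + 1) ∨
        (Incomp prec (v j) (v (j + 1)) ∧ h (v j) = h (v (j + 1)) + 1)) ∧
      (∀ a ∈ {w | ∃ j ≤ n, v j = w}, ∀ b ∈ {w | ∃ j ≤ n, v j = w},
        ∀ d ∈ {w | ∃ j ≤ n, v j = w}, h a = h b → h a = h d → a = b ∨ a = d ∨ b = d) ∧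
      (∀ a ∈ {w | ∃ j ≤ n, v j = w}, ∀ b ∈ {w | ∃ j ≤ n, v j = w},
        ∀ a' ∈ {w | ∃ j ≤ n, v j = w}, ∀ b' ∈ {w | ∃ j ≤ n, v j = w},
        h a = h b → h a' = h a + 1 → h b' = h a + 1 → a = b ∨ a' = b') := by
    rcases hcase with ⟨⟨c, τ, hrep⟩, hfree⟩ | ⟨⟨c, τ, hrep⟩, hfree⟩ | ⟨⟨c, τ, hrep⟩, hfree⟩ <;>
      obtain ⟨h, c₀, H, hc, hstep⟩ := hrep.exists_level hn hv hcyc hval <;>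
      refine ⟨h, H, hstep, hrep.level_bounds htf hc ?_⟩ <;>
      intro a ha b hb a' ha' b' hb'
    · exact hrep.not_double_CD hfree hc ha hb ha' hb'
    · exact H.not_double_AB hrep hfree hc ha hb ha' hb'
    · exact H.not_double_AC hrep hfree hc ha hb ha' hb'
  obtain ⟨q, hq, xe, ye, ze, hmax, hx, hyz⟩ := H.exists_alternating two nn
  have visited : ∀ j ≤ n, v j ∈ {w | ∃ j ≤ n, v j = w} := fun j hj => ⟨j, hj, rfl⟩
  refine ⟨q, hq, xe, ye, ze, fun i hi j hj e => ?_, fun i hi j hj e => ?_, fun i hi j hj e => ?_,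
    fun i hi j hj e => ?_, fun i hi j hj e => ?_, fun i hi j hj e => ?_, ?_,
    fun j hj hp => ?_, fun j hj hp => ?_⟩
  · have := congrArg h e
    rw [(hx i hi).2.1, (hx j hj).2.1] at this
    omega
  · have := congrArg h e
    rw [(hyz i hi).2.2.1, (hyz j hj).2.2.1] at this
    omega
  · have := congrArg h e
    rw [(hyz i hi).2.2.2.1, (hyz j hj).2.2.2.1] at this
    omega
  · have := congrArg h e
    rw [(hx i hi).2.1, (hyz j hj).2.2.1] at this
    omega
  · have := congrArg h e
    rw [(hx i hi).2.1, (hyz j hj).2.2.2.1] at this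
    omega
  · have hij := congrArg h e
    rw [(hyz i hi).2.2.1, (hyz j hj).2.2.2.1] at hij
    obtain rfl : i = j := by omega
    obtain ⟨-, -, -, -, -, hxy, hxz, -, -⟩ := hyz i hi
    exact hxz.1 (e ▸ hxy)
  · ext w
    constructor
    · intro hw
      have hwq := hmax w hw
      rcases Nat.even_or_odd' (h w) with ⟨k, hk | hk⟩
      · exact Or.inl ⟨k, by omega, ((hx k (by omega)).2.2 w hw hk).symm⟩
      · have hkq : k < q := by omega
        rcases (hyz k hkq).2.2.2.2.1 w hw hk with e | e
        · exact Or.inr (Or.inl ⟨k, hkq, e.symm⟩)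
        · exact Or.inr (Or.inr ⟨k, hkq, e.symm⟩)
    · rintro (⟨i, hi, rfl⟩ | ⟨i, hi, rfl⟩ | ⟨i, hi, rfl⟩)
      · exact (hx i hi).1
      · exact (hyz i hi).1
      · exact (hyz i hi).2.1
  · have hl : h (v (j + 1)) = h (v j) + 1 := by
      rcases hstep j hj with hs | hs
      · exact hs.2
      · exact absurd hp hs.1.1
    have h1 := visited j hj.le
    have h2 := visited (j + 1) hj
    have hmx := hmax _ h2
    rcases Nat.even_or_odd' (h (v j)) with ⟨k, hk | hk⟩ <;> have hkq : k < q := by omega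
    all_goals
      obtain ⟨-, -, -, -, hmem, -, hxz, -, hzx⟩ := hyz k hkq
      refine ⟨k, hkq, ?_⟩
    · have e1 := (hx k hkq.le).2.2 _ h1 hk
      rcases hmem _ h2 (by omega) with e2 | e2 <;> rw [e1, e2] at hp ⊢
      · exact Or.inl rfl
      · exact absurd hp hxz.1
    · have e2 := (hx (k + 1) hkq).2.2 _ h2 (by omega)
      rcases hmem _ h1 hk with e1 | e1 <;> rw [e1, e2] at hp ⊢
      · exact Or.inr rfl
      · exact absurd hp hzx.1
  · have hl : h (v j) = h (v (j + 1)) + 1 := by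
      rcases hstep j hj with hs | hs
      · exact absurd hs.1 hp.1
      · exact hs.2
    have h1 := visited j hj.le
    have h2 := visited (j + 1) hj
    have hmx := hmax _ h1
    rcases Nat.even_or_odd' (h (v (j + 1))) with ⟨k, hk | hk⟩ <;> have hkq : k < q := by omega
    all_goals
      obtain ⟨-, -, -, -, hmem, hxy, -, hyx, -⟩ := hyz k hkq
      refine ⟨k, hkq, ?_⟩
      rw [Set.pair_comm]
    · have e2 := (hx k hkq.le).2.2 _ h2 hk
      rcases hmem _ h1 (by omega) with e1 | e1 <;> rw [e1, e2] at hp ⊢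
      · exact absurd hxy hp.2
      · exact Or.inl rfl
    · have e1 := (hx (k + 1) hkq).2.2 _ h1 (by omega)
      rcases hmem _ h2 hk with e2 | e2 <;> rw [e1, e2] at hp ⊢
      · exact absurd hyx hp.2
      · exact Or.inr rfl
end
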